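/- Let n ≥ 0 and q ≥ n+1 be integers, with quadrature nodes and weights (ζ_k, ν_k) and (ξ_j, ω_j) as above, and let Q_q[g] = Σ_{i=1}^{2q} Σ_{j=1}^{q} Σ_{k=1}^{q} (π/q)·ω_j·ν_k·g̃((ζ_k+1)/2, πi/q, arccos ξ_j) denote the resulting quadrature rule on B₃. Then for every polynomial p ∈ ℝ[x,y,z] of total degree at most n and every (x,y,z) ∈ B₃: p(x,y,z) = Σ_{m=0}^{n} Σ_{j+k≤m} Q_q[p·Q_m^{j,k}]·Q_m^{j,k}(x,y,z); that is, the discrete L² projection reproduces all polynomials of degree at most n. -/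

import Mathlib

open MeasureTheory Real Filter

/-- The Gegenbauer polynomials `C_n^λ`, defined by their triple recursion. -/
noncomputable def gegenbauer (lam : ℝ) : ℕ → ℝ → ℝ
  | 0, _ => 1
  | 1, t => 2 * lam * t
  | (n + 2), t =>
      (2 * (((n : ℝ) + 1) + lam) / ((n : ℝ) + 2)) * t * gegenbauer lam (n + 1) t
        - ((((n : ℝ) + 1) + 2 * lam - 1) / ((n : ℝ) + 2)) * gegenbauer lam n t

/-- The open unit ball in `ℝ³`. -/
def unitBall3 : Set (ℝ × ℝ × ℝ) := {p | p.1 ^ 2 + p.2.1 ^ 2 + p.2.2 ^ 2 < 1}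

/-- `(N_m^{[μ]})²`, the squared weighted `L²`-norm of the Gegenbauer
polynomial `C_m^μ`. -/
noncomputable def Nsq (mu : ℝ) (m : ℕ) : ℝ :=
  π * Real.Gamma (2 * mu + m) /
    ((2 : ℝ) ^ (2 * mu - 1) * (Nat.factorial m : ℝ) * (mu + m) * Real.Gamma mu ^ 2)

/-- The normalization constant `h_{j,k,n}`. -/
noncomputable def h3 (j k n : ℕ) : ℝ :=
  Real.sqrt (Nsq (1 / 2) k * Nsq ((k : ℝ) + 1) j *
    Nsq ((j : ℝ) + (k : ℝ) + 3 / 2) (n - j - k))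

/-- The orthonormal polynomial basis `Q_n^{j,k}` on the unit ball. -/
noncomputable def Q3 (n j k : ℕ) (x y z : ℝ) : ℝ :=
  (1 / h3 j k n) * gegenbauer ((j : ℝ) + (k : ℝ) + 3 / 2) (n - j - k) x *
    (1 - x ^ 2) ^ ((j : ℝ) / 2) * gegenbauer ((k : ℝ) + 1) j (y / Real.sqrt (1 - x ^ 2)) *
    (1 - x ^ 2 - y ^ 2) ^ ((k : ℝ) / 2) *
    gegenbauer (1 / 2) k (z / Real.sqrt (1 - x ^ 2 - y ^ 2))

/-- The homogenized Gegenbauer polynomial `s^{n/2} C_n^λ(y/√s)`, as an element of any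
commutative `ℝ`-algebra. -/
noncomputable def homGegenbauer {A : Type*} [CommRing A] [Algebra ℝ A] (lam : ℝ) (y s : A) :
    ℕ → A
  | 0 => 1
  | 1 => (2 * lam) • y
  | (n + 2) =>
      (2 * (((n : ℝ) + 1) + lam) / ((n : ℝ) + 2)) • (y * homGegenbauer lam y s (n + 1))
        - ((((n : ℝ) + 1) + 2 * lam - 1) / ((n : ℝ) + 2)) • (s * homGegenbauer lam y s n)

section HomGegenbauer

variable {A B : Type*} [CommRing A] [Algebra ℝ A] [CommRing B] [Algebra ℝ B]

lemma map_homGegenbauer (φ : A →ₐ[ℝ] B) (lam : ℝ) (y s : A) (n : ℕ) :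
    φ (homGegenbauer lam y s n) = homGegenbauer lam (φ y) (φ s) n := by
  induction n using Nat.twoStepInduction with
  | zero => simp [homGegenbauer]
  | one => simp [homGegenbauer]
  | more n ih0 ih1 => simp only [homGegenbauer, map_sub, map_smul, map_mul, ih0, ih1]

lemma homGegenbauer_mul (lam : ℝ) (r y s : A) (n : ℕ) :
    homGegenbauer lam (r * y) (r ^ 2 * s) n = r ^ n * homGegenbauer lam y s n := by
  induction n using Nat.twoStepInduction with
  | zero => simp [homGegenbauer]
  | one => simp [homGegenbauer]
  | more n ih0 ih1 =>
    simp only [homGegenbauer, ih0, ih1, mul_sub, Algebra.smul_def]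
    ring

lemma homGegenbauer_one_eq (lam t : ℝ) (n : ℕ) :
    homGegenbauer lam t 1 n = gegenbauer lam n t := by
  induction n using Nat.twoStepInduction with
  | zero => simp [homGegenbauer, gegenbauer]
  | one => simp [homGegenbauer, gegenbauer]
  | more n ih0 ih1 =>
    simp only [homGegenbauer, gegenbauer, ih0, ih1, smul_eq_mul]
    ring

lemma homGegenbauer_mul_sq (lam r u : ℝ) (n : ℕ) :
    homGegenbauer lam (r * u) (r ^ 2) n = r ^ n * gegenbauer lam n u := by
  rw [← homGegenbauer_one_eq, ← homGegenbauer_mul, mul_one]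

lemma totalDegree_homGegenbauer_le {σ : Type*} (lam : ℝ) {y s : MvPolynomial σ ℝ}
    (hy : y.totalDegree ≤ 1) (hs : s.totalDegree ≤ 2) (n : ℕ) :
    (homGegenbauer lam y s n).totalDegree ≤ n := by
  induction n using Nat.twoStepInduction with
  | zero => simp [homGegenbauer]
  | one => exact (MvPolynomial.totalDegree_smul_le _ _).trans hy
  | more n ih0 ih1 =>
    refine (MvPolynomial.totalDegree_sub _ _).trans (max_le ?_ ?_)
    · refine (MvPolynomial.totalDegree_smul_le _ _).trans
        ((MvPolynomial.totalDegree_mul _ _).trans ?_)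
      omega
    · refine (MvPolynomial.totalDegree_smul_le _ _).trans
        ((MvPolynomial.totalDegree_mul _ _).trans ?_)
      omega

end HomGegenbauer

section GegenbauerPolynomial

open Polynomial

/-- The Gegenbauer polynomial as an element of `ℝ[X]`. -/
noncomputable def gegenbauerPoly (lam : ℝ) (n : ℕ) : ℝ[X] := homGegenbauer lam X 1 n

lemma eval_gegenbauerPoly (lam t : ℝ) (n : ℕ) :
    (gegenbauerPoly lam n).eval t = gegenbauer lam n t := by
  have h := map_homGegenbauer (aeval t : ℝ[X] →ₐ[ℝ] ℝ) lam X 1 n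
  rwa [aeval_X, map_one, homGegenbauer_one_eq, coe_aeval_eq_eval] at h

lemma gegenbauerPoly_recurrence (lam : ℝ) (n : ℕ) :
    ((n : ℝ[X]) + 2) * gegenbauerPoly lam (n + 2) =
      2 * ((n : ℝ[X]) + 1 + C lam) * X * gegenbauerPoly lam (n + 1)
        - ((n : ℝ[X]) + 2 * C lam) * gegenbauerPoly lam n := by
  have hn : (n : ℝ) + 2 ≠ 0 := by positivity
  have h (a : ℝ) : ((n : ℝ[X]) + 2) * C (a / (n + 2)) = C a := by
    have : ((n : ℝ[X]) + 2) = C ((n : ℝ) + 2) := by simp [map_ofNat]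
    rw [this, ← C_mul, mul_div_cancel₀ _ hn]
  simp only [gegenbauerPoly, homGegenbauer, smul_eq_C_mul, mul_sub]
  simp only [← mul_assoc, h]
  simp only [map_mul, map_add, map_sub, map_ofNat, map_natCast, map_one]
  ring

lemma derivative_gegenbauerPoly_aux (lam : ℝ) (n : ℕ) :
    derivative (gegenbauerPoly lam (n + 1)) =
        X * derivative (gegenbauerPoly lam n) + ((n : ℝ[X]) + 2 * C lam) * gegenbauerPoly lam n ∧
      X * derivative (gegenbauerPoly lam (n + 1)) =
        derivative (gegenbauerPoly lam n) + ((n : ℝ[X]) + 1) * gegenbauerPoly lam (n + 1) := by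
  induction n with
  | zero =>
    simp [gegenbauerPoly, homGegenbauer, smul_eq_C_mul, map_ofNat]
    ring
  | succ n ih =>
    obtain ⟨hA, hB⟩ := ih
    have hn : ((n : ℝ[X]) + 2) ≠ 0 := by
      have h : ((n + 2 : ℕ) : ℝ[X]) ≠ 0 := Nat.cast_ne_zero.2 (by omega)
      rwa [Nat.cast_add, Nat.cast_ofNat] at h
    have hR := gegenbauerPoly_recurrence lam n
    have hD := congrArg derivative hR
    simp only [derivative_mul, derivative_sub, derivative_add, derivative_natCast,
      derivative_ofNat, derivative_C, derivative_X, derivative_one] at hD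
    have hA' : derivative (gegenbauerPoly lam (n + 2)) =
        X * derivative (gegenbauerPoly lam (n + 1)) +
          ((n : ℝ[X]) + 1 + 2 * C lam) * gegenbauerPoly lam (n + 1) := by
      apply mul_left_cancel₀ hn
      linear_combination hD + ((n : ℝ[X]) + 2 * C lam) * hB
    push_cast
    refine ⟨hA', ?_⟩
    linear_combination X * hA' - hR + X * hB - hA

lemma gegenbauerPoly_ode (lam : ℝ) (n : ℕ) :
    (1 - X ^ 2) * derivative (derivative (gegenbauerPoly lam n))
        - C (2 * lam + 1) * X * derivative (gegenbauerPoly lam n) =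
      - C (n * (n + 2 * lam)) * gegenbauerPoly lam n := by
  cases n with
  | zero => simp [gegenbauerPoly, homGegenbauer]
  | succ n =>
    obtain ⟨hA, hB⟩ := derivative_gegenbauerPoly_aux lam n
    have hD : (1 - X ^ 2) * derivative (gegenbauerPoly lam (n + 1)) =
        - ((n : ℝ[X]) + 1) * X * gegenbauerPoly lam (n + 1) + ((n : ℝ[X]) + 2 * C lam) * gegenbauerPoly lam n := by
      linear_combination hA - X * hB
    have hD' := congrArg derivative hD
    simp only [derivative_mul, derivative_sub, derivative_add, derivative_natCast, derivative_neg,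
      derivative_ofNat, derivative_C, derivative_X, derivative_one, derivative_X_pow] at hD'
    simp [map_ofNat] at hD' ⊢
    linear_combination hD' - ((n : ℝ[X]) + 2 * C lam) * hB

end GegenbauerPolynomial

section WeightedIntegral

open Polynomial

lemma continuous_eval_mul_sqrt_pow (M : ℕ) (f : ℝ[X]) :
    Continuous fun t : ℝ => f.eval t * √(1 - t ^ 2) ^ M := by
  have := f.continuous
  fun_prop

/-- The functional `f ↦ ∫_{-1}^1 f(t) (1 - t²)^{M/2} dt` on polynomials. -/
noncomputable def weightedIntegral (M : ℕ) : ℝ[X] →ₗ[ℝ] ℝ where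
  toFun f := ∫ t in (-1 : ℝ)..1, f.eval t * √(1 - t ^ 2) ^ M
  map_add' f g := by
    simp only [eval_add, add_mul]
    exact intervalIntegral.integral_add
      ((continuous_eval_mul_sqrt_pow M f).intervalIntegrable _ _)
      ((continuous_eval_mul_sqrt_pow M g).intervalIntegrable _ _)
  map_smul' c f := by
    simp [mul_assoc]

lemma weightedIntegral_apply (M : ℕ) (f : ℝ[X]) :
    weightedIntegral M f = ∫ t in (-1 : ℝ)..1, f.eval t * √(1 - t ^ 2) ^ M := rfl

lemma weightedIntegral_one_sub_sq_mul (M : ℕ) (f : ℝ[X]) :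
    weightedIntegral M ((1 - X ^ 2) * f) = weightedIntegral (M + 2) f := by
  simp only [weightedIntegral_apply]
  refine intervalIntegral.integral_congr fun t ht => ?_
  rw [Set.uIcc_of_le (by norm_num)] at ht
  have h : 0 ≤ 1 - t ^ 2 := by nlinarith [ht.1, ht.2]
  simp only [eval_mul, eval_sub, eval_one, eval_pow, eval_X, pow_add, Real.sq_sqrt h]
  ring

lemma weightedIntegral_derivative (M : ℕ) (f : ℝ[X]) :
    weightedIntegral M ((1 - X ^ 2) * derivative f - C ((M : ℝ) + 2) * X * f) = 0 := by
  have hderiv : ∀ t ∈ Set.Ioo (-1 : ℝ) 1,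
      HasDerivAt (fun t : ℝ => f.eval t * √(1 - t ^ 2) ^ (M + 2))
        (((1 - X ^ 2) * derivative f - C ((M : ℝ) + 2) * X * f).eval t * √(1 - t ^ 2) ^ M) t := by
    intro t ht
    have h : 0 < 1 - t ^ 2 := by nlinarith [ht.1, ht.2]
    have hs := (((hasDerivAt_pow 2 t).const_sub 1).sqrt h.ne').pow (M + 2)
    have := (f.hasDerivAt t).mul hs
    refine this.congr_deriv ?_
    have h0 : √(1 - t ^ 2) ≠ 0 := (Real.sqrt_pos.2 h).ne'
    simp only [eval_mul, eval_sub, eval_one, eval_pow, eval_X, eval_C, Pi.pow_apply]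
    have h2 : 1 - t ^ 2 = √(1 - t ^ 2) ^ 2 := (Real.sq_sqrt h.le).symm
    generalize √(1 - t ^ 2) = r at *
    rw [h2, show M + 2 - 1 = M + 1 from rfl]
    push_cast
    field_simp
    ring
  rw [weightedIntegral_apply, intervalIntegral.integral_eq_sub_of_hasDerivAt_of_le (by norm_num)
    (continuous_eval_mul_sqrt_pow (M + 2) f).continuousOn hderiv
    ((continuous_eval_mul_sqrt_pow M _).intervalIntegrable _ _)]
  simp

lemma weightedIntegral_X_pow_add_two (M a : ℕ) :
    ((M : ℝ) + a + 3) * weightedIntegral M (X ^ (a + 2)) = (a + 1) * weightedIntegral M (X ^ a) := by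
  have h := weightedIntegral_derivative M (X ^ (a + 1))
  have h1 : (1 - X ^ 2) * derivative (X ^ (a + 1)) - C ((M : ℝ) + 2) * X * X ^ (a + 1) =
      ((a : ℝ) + 1) • X ^ a - ((M : ℝ) + a + 3) • X ^ (a + 2) := by
    simp only [derivative_X_pow, smul_eq_C_mul, map_add, map_natCast, map_ofNat, map_one]
    push_cast
    ring
  rw [h1, map_sub, map_smul, map_smul, smul_eq_mul, smul_eq_mul] at h
  linarith

lemma weightedIntegral_add_two_X_pow (M a : ℕ) :
    ((M : ℝ) + a + 3) * weightedIntegral (M + 2) (X ^ a) =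
      (M + 2) * weightedIntegral M (X ^ a) := by
  have h := weightedIntegral_X_pow_add_two M a
  rw [← weightedIntegral_one_sub_sq_mul, sub_mul, one_mul, ← pow_add, map_sub, add_comm 2 a]
  linarith

lemma weightedIntegral_X (M : ℕ) : weightedIntegral M X = 0 := by
  have h := weightedIntegral_derivative M 1
  have h1 : (1 - X ^ 2) * derivative 1 - C ((M : ℝ) + 2) * X * 1 = (-((M : ℝ) + 2)) • X := by
    simp [smul_eq_C_mul]
    ring
  rw [h1, map_smul, smul_eq_mul] at h
  exact (mul_eq_zero.1 h).resolve_left (by linarith [(Nat.cast_nonneg M : (0 : ℝ) ≤ M)])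

lemma weightedIntegral_zero_one : weightedIntegral 0 1 = 2 := by
  simp [weightedIntegral_apply]
  norm_num

lemma weightedIntegral_one_one : weightedIntegral 1 1 = π / 2 := by
  simp only [weightedIntegral_apply, eval_one, one_mul, pow_one]
  exact integral_sqrt_one_sub_sq

lemma weightedIntegral_one_eq_Nsq (M : ℕ) :
    weightedIntegral M 1 = Nsq (((M : ℝ) + 1) / 2) 0 := by
  induction M using Nat.twoStepInduction with
  | zero =>
    rw [weightedIntegral_zero_one, Nsq]
    norm_num [Real.Gamma_one_half_eq, Real.sq_sqrt Real.pi_pos.le]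
    field_simp
  | one =>
    rw [weightedIntegral_one_one, Nsq]
    norm_num [Real.Gamma_one]
  | more M ih0 _ =>
    have h := weightedIntegral_add_two_X_pow M 0
    simp only [pow_zero, ih0] at h
    have hM : (0 : ℝ) ≤ M := Nat.cast_nonneg M
    refine mul_left_cancel₀ (show (M : ℝ) + 3 ≠ 0 by positivity) ?_
    push_cast at h ⊢
    rw [add_zero] at h
    rw [h]
    set lam : ℝ := ((M : ℝ) + 1) / 2 with hlam
    have hpos : 0 < lam := by positivity
    have e1 : ((M : ℝ) + 2 + 1) / 2 = lam + 1 := by rw [hlam]; ring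
    have e2 : (M : ℝ) = 2 * lam - 1 := by rw [hlam]; ring
    rw [e1, e2]
    simp only [Nsq, Nat.cast_zero, add_zero, Nat.factorial_zero, Nat.cast_one]
    rw [show 2 * (lam + 1) = 2 * lam + 1 + 1 by ring, Real.Gamma_add_one (by positivity),
      Real.Gamma_add_one (show 2 * lam ≠ 0 by positivity), Real.Gamma_add_one hpos.ne',
      show 2 * lam + 1 + 1 - 1 = 2 * lam - 1 + (2 : ℕ) by push_cast; ring,
      Real.rpow_add_natCast (by norm_num)]
    have := (Real.Gamma_pos_of_pos hpos).ne'
    have := (Real.rpow_pos_of_pos (show (0 : ℝ) < 2 by norm_num) (2 * lam - 1)).ne'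
    field_simp
    ring

lemma Nsq_pos {mu : ℝ} (hmu : 0 < mu) (m : ℕ) : 0 < Nsq mu m := by
  have := Real.Gamma_pos_of_pos hmu
  have := Real.Gamma_pos_of_pos (show 0 < 2 * mu + m by positivity)
  unfold Nsq
  positivity

lemma Nsq_succ {mu : ℝ} (hmu : 0 < mu) (m : ℕ) :
    ((m : ℝ) + 1) * (m + 1 + mu) * Nsq mu (m + 1) = (m + mu) * (m + 2 * mu) * Nsq mu m := by
  have := (Real.Gamma_pos_of_pos hmu).ne'
  have := (Real.rpow_pos_of_pos (show (0 : ℝ) < 2 by norm_num) (2 * mu - 1)).ne'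
  have : ((m.factorial : ℕ) : ℝ) ≠ 0 := by positivity
  simp only [Nsq, Nat.factorial_succ]
  push_cast
  rw [show 2 * mu + ((m : ℝ) + 1) = 2 * mu + m + 1 by ring, Real.Gamma_add_one (by positivity)]
  have : mu + m ≠ 0 := by positivity
  have : mu + (m + 1) ≠ 0 := by positivity
  field_simp
  ring

lemma weightedIntegral_gegenbauer_energy {M : ℕ} {lam : ℝ} (hM : (M : ℝ) + 1 = 2 * lam)
    (n : ℕ) (g : ℝ[X]) :
    weightedIntegral M ((1 - X ^ 2) * derivative (gegenbauerPoly lam n) * derivative g) =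
      n * (n + 2 * lam) * weightedIntegral M (gegenbauerPoly lam n * g) := by
  have h := weightedIntegral_derivative M (derivative (gegenbauerPoly lam n) * g)
  have hode := gegenbauerPoly_ode lam n
  have h1 : (1 - X ^ 2) * derivative (derivative (gegenbauerPoly lam n) * g) -
        C ((M : ℝ) + 2) * X * (derivative (gegenbauerPoly lam n) * g) =
      (1 - X ^ 2) * derivative (gegenbauerPoly lam n) * derivative g -
        ((n : ℝ) * (n + 2 * lam)) • (gegenbauerPoly lam n * g) := by
    rw [derivative_mul, smul_eq_C_mul, show (M : ℝ) + 2 = 2 * lam + 1 by linarith]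
    linear_combination g * hode
  rw [h1, map_sub, map_smul, smul_eq_mul] at h
  linarith

lemma weightedIntegral_gegenbauer_of_ne {M : ℕ} {lam : ℝ} (hM : (M : ℝ) + 1 = 2 * lam)
    {n m : ℕ} (hnm : n ≠ m) :
    weightedIntegral M (gegenbauerPoly lam n * gegenbauerPoly lam m) = 0 := by
  have h1 := weightedIntegral_gegenbauer_energy hM n (gegenbauerPoly lam m)
  have h2 := weightedIntegral_gegenbauer_energy hM m (gegenbauerPoly lam n)
  rw [mul_right_comm, h1, mul_comm (gegenbauerPoly lam m)] at h2
  have h3 : ((n : ℝ) - m) * (n + m + 2 * lam) *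
      weightedIntegral M (gegenbauerPoly lam n * gegenbauerPoly lam m) = 0 := by
    linear_combination h2
  have h4 : (n : ℝ) + m + 2 * lam ≠ 0 := by rw [← hM]; positivity
  have h5 : (n : ℝ) - m ≠ 0 := sub_ne_zero.2 (Nat.cast_injective.ne hnm)
  simpa [h4, h5] using h3

lemma weightedIntegral_gegenbauer_sq {M : ℕ} {lam : ℝ} (hM : (M : ℝ) + 1 = 2 * lam) (n : ℕ) :
    weightedIntegral M (gegenbauerPoly lam n * gegenbauerPoly lam n) = Nsq lam n := by
  have hlam : 0 < lam := by linarith [(Nat.cast_nonneg M : (0 : ℝ) ≤ M)]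
  induction n with
  | zero =>
    rw [show lam = ((M : ℝ) + 1) / 2 by linarith, ← weightedIntegral_one_eq_Nsq]
    simp [gegenbauerPoly, homGegenbauer]
  | succ n ih =>
    set P := gegenbauerPoly lam with hP
    have hE : ((n : ℝ) + 2 * lam) * weightedIntegral M (P n * P n) =
        2 * (n + 1 + lam) * weightedIntegral M (X * P n * P (n + 1)) := by
      have h0 : weightedIntegral M (P (n + 2) * P n) = 0 :=
        weightedIntegral_gegenbauer_of_ne hM (by omega)
      have h1 : ((n : ℝ) + 2) • (P (n + 2) * P n) =
          (2 * ((n : ℝ) + 1 + lam)) • (X * P n * P (n + 1)) -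
            ((n : ℝ) + 2 * lam) • (P n * P n) := by
        simp only [smul_eq_C_mul, map_add, map_mul, map_natCast, map_ofNat, map_one]
        linear_combination P n * gegenbauerPoly_recurrence lam n
      have h2 := congrArg (weightedIntegral M) h1
      simp only [map_sub, map_smul, smul_eq_mul, h0] at h2
      linarith
    have hF : ((n : ℝ) + 1) * weightedIntegral M (P (n + 1) * P (n + 1)) =
        2 * (n + lam) * weightedIntegral M (X * P n * P (n + 1)) := by
      cases n with
      | zero =>
        have h1 : P 1 * P 1 = (2 * lam) • (X * P 0 * P 1) := by
          simp [hP, gegenbauerPoly, homGegenbauer]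
        rw [h1, map_smul, smul_eq_mul]
        simp
      | succ n =>
        have h0 : weightedIntegral M (P n * P (n + 2)) = 0 :=
          weightedIntegral_gegenbauer_of_ne hM (by omega)
        have h1 : ((n : ℝ) + 2) • (P (n + 2) * P (n + 2)) =
            (2 * ((n : ℝ) + 1 + lam)) • (X * P (n + 1) * P (n + 2)) -
              ((n : ℝ) + 2 * lam) • (P n * P (n + 2)) := by
          simp only [smul_eq_C_mul, map_add, map_mul, map_natCast, map_ofNat, map_one]
          linear_combination P (n + 2) * gegenbauerPoly_recurrence lam n
        have h2 := congrArg (weightedIntegral M) h1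
        simp only [map_sub, map_smul, smul_eq_mul, h0] at h2
        push_cast
        linarith
    rw [ih] at hE
    have hN := Nsq_succ hlam n
    refine mul_left_cancel₀ (show ((n : ℝ) + 1) * (n + 1 + lam) ≠ 0 by positivity) ?_
    linear_combination (n + 1 + lam) * hF - (n + lam) * hE - hN

lemma weightedIntegral_gegenbauer {M : ℕ} {lam : ℝ} (hM : (M : ℝ) + 1 = 2 * lam) (n m : ℕ) :
    weightedIntegral M (gegenbauerPoly lam n * gegenbauerPoly lam m) =
      if n = m then Nsq lam n else 0 := by
  split_ifs with h
  · rw [← h, weightedIntegral_gegenbauer_sq hM]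
  · exact weightedIntegral_gegenbauer_of_ne hM h

end WeightedIntegral

section TrigonometricQuadrature

lemma sum_exp_equispaced {q : ℕ} (hq : 0 < q) {m : ℤ} (hm : m.natAbs < 2 * q) :
    ∑ i ∈ Finset.Icc 1 (2 * q),
        ((π / q : ℝ) : ℂ) * Complex.exp (m * (π * i / q : ℝ) * Complex.I) =
      ∫ θ in (0 : ℝ)..2 * π, Complex.exp (m * θ * Complex.I) := by
  have hq' : (q : ℂ) ≠ 0 := by exact_mod_cast hq.ne'
  have hπ : (π : ℂ) ≠ 0 := by exact_mod_cast Real.pi_ne_zero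
  rcases eq_or_ne m 0 with rfl | h0
  · simp
    field_simp
  have hm0 : (m : ℂ) ≠ 0 := by exact_mod_cast h0
  set z : ℂ := Complex.exp (m * (π / q) * Complex.I) with hz
  have hz1 : z ≠ 1 := by
    rw [hz, Ne, Complex.exp_eq_one_iff]
    rintro ⟨k, hk⟩
    have h1 : (m : ℂ) = 2 * q * k := by
      field_simp at hk
      linear_combination hk
    have h2 : m = 2 * q * k := by exact_mod_cast h1
    rcases eq_or_ne k 0 with rfl | hk0
    · simp at h2
      exact h0 h2
    · have : 1 ≤ k.natAbs := Int.natAbs_pos.2 hk0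
      have h3 : m.natAbs = 2 * q * k.natAbs := by rw [h2]; simp [Int.natAbs_mul]
      nlinarith
  have hzq : z ^ (2 * q) = 1 := by
    rw [hz, ← Complex.exp_nat_mul, Complex.exp_eq_one_iff]
    refine ⟨m, ?_⟩
    push_cast
    field_simp
  have hsum : ∑ i ∈ Finset.Icc 1 (2 * q), z ^ i = 0 := by
    have h1 : ∑ i ∈ Finset.Icc 1 (2 * q), z ^ i = z * ∑ i ∈ Finset.range (2 * q), z ^ i := by
      rw [Finset.mul_sum, Finset.range_eq_Ico, ← Finset.Ico_add_one_right_eq_Icc,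
        ← Finset.sum_Ico_add' _ 0 (2 * q) 1]
      simp [pow_succ']
    rw [h1, geom_sum_eq hz1, hzq]
    simp
  have hleft : ∑ i ∈ Finset.Icc 1 (2 * q),
      ((π / q : ℝ) : ℂ) * Complex.exp (m * (π * i / q : ℝ) * Complex.I) = 0 := by
    rw [← Finset.mul_sum, ← mul_zero ((π / q : ℝ) : ℂ), ← hsum]
    congr 1
    refine Finset.sum_congr rfl fun i _ => ?_
    rw [hz, ← Complex.exp_nat_mul]
    congr 1
    push_cast
    ring
  have hright := integral_exp_mul_complex (a := 0) (b := 2 * π) (c := m * Complex.I)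
    (mul_ne_zero hm0 Complex.I_ne_zero)
  rw [hleft]
  simp_rw [mul_right_comm _ _ Complex.I]
  rw [hright, Complex.exp_eq_one_iff.2 ⟨m, by push_cast; ring⟩]
  simp

lemma cos_mul_exp (θ : ℝ) (m : ℤ) :
    (Real.cos θ : ℂ) * Complex.exp (m * θ * Complex.I) =
      1 / 2 * Complex.exp ((m + 1 : ℤ) * θ * Complex.I) +
        1 / 2 * Complex.exp ((m - 1 : ℤ) * θ * Complex.I) := by
  rw [Complex.ofReal_cos, Complex.cos]
  push_cast
  rw [show ((m : ℂ) + 1) * θ * Complex.I = θ * Complex.I + m * θ * Complex.I by ring,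
    show ((m : ℂ) - 1) * θ * Complex.I = -θ * Complex.I + m * θ * Complex.I by ring,
    Complex.exp_add, Complex.exp_add]
  ring

lemma sin_mul_exp (θ : ℝ) (m : ℤ) :
    (Real.sin θ : ℂ) * Complex.exp (m * θ * Complex.I) =
      -Complex.I / 2 * Complex.exp ((m + 1 : ℤ) * θ * Complex.I) +
        Complex.I / 2 * Complex.exp ((m - 1 : ℤ) * θ * Complex.I) := by
  rw [Complex.ofReal_sin, Complex.sin]
  push_cast
  rw [show ((m : ℂ) + 1) * θ * Complex.I = θ * Complex.I + m * θ * Complex.I by ring,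
    show ((m : ℂ) - 1) * θ * Complex.I = -θ * Complex.I + m * θ * Complex.I by ring,
    Complex.exp_add, Complex.exp_add]
  ring

/-- The trapezoidal rule with `2q` nodes integrates `f` exactly over a period. -/
def TrapezoidalExact (q : ℕ) (f : ℝ → ℂ) : Prop :=
  ∑ i ∈ Finset.Icc 1 (2 * q), ((π / q : ℝ) : ℂ) * f (π * i / q) = ∫ θ in (0 : ℝ)..2 * π, f θ

lemma TrapezoidalExact.combination {q : ℕ} {f g h : ℝ → ℂ} (eg : TrapezoidalExact q g)
    (eh : TrapezoidalExact q h) (hg : Continuous g) (hh : Continuous h) (c d : ℂ)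
    (hf : ∀ θ, f θ = c * g θ + d * h θ) : TrapezoidalExact q f := by
  unfold TrapezoidalExact at *
  simp_rw [hf]
  rw [intervalIntegral.integral_add ((hg.const_mul c).intervalIntegrable _ _)
    ((hh.const_mul d).intervalIntegrable _ _), intervalIntegral.integral_const_mul,
    intervalIntegral.integral_const_mul, ← eg, ← eh, Finset.mul_sum, Finset.mul_sum,
    ← Finset.sum_add_distrib]
  exact Finset.sum_congr rfl fun i _ => by ring

lemma trapezoidalExact_cos_pow_mul_sin_pow_mul_exp {q : ℕ} (hq : 0 < q) (a b : ℕ) (m : ℤ)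
    (h : a + b + m.natAbs < 2 * q) :
    TrapezoidalExact q fun θ => (Real.cos θ : ℂ) ^ a * (Real.sin θ : ℂ) ^ b *
      Complex.exp (m * θ * Complex.I) := by
  induction a generalizing m with
  | zero =>
    induction b generalizing m with
    | zero =>
      simp only [pow_zero, one_mul]
      exact sum_exp_equispaced hq (by omega)
    | succ b ih =>
      refine (ih (m + 1) (by omega)).combination (ih (m - 1) (by omega)) (by fun_prop)
        (by fun_prop) (-Complex.I / 2) (Complex.I / 2) fun θ => ?_
      linear_combination (Real.cos θ : ℂ) ^ 0 * (Real.sin θ : ℂ) ^ b * sin_mul_exp θ m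
  | succ a ih =>
    refine (ih (m + 1) (by omega)).combination (ih (m - 1) (by omega)) (by fun_prop)
      (by fun_prop) (1 / 2) (1 / 2) fun θ => ?_
    linear_combination (Real.cos θ : ℂ) ^ a * (Real.sin θ : ℂ) ^ b * cos_mul_exp θ m

/-- The integral `∫_0^{2π} cos^a θ sin^b θ dθ`. -/
noncomputable def trigMoment (a b : ℕ) : ℝ :=
  ∫ θ in (0 : ℝ)..2 * π, Real.cos θ ^ a * Real.sin θ ^ b

lemma trapezoidal_cos_pow_mul_sin_pow {q a b : ℕ} (hab : a + b < 2 * q) :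
    ∑ i ∈ Finset.Icc 1 (2 * q),
        π / q * (Real.cos (π * i / q) ^ a * Real.sin (π * i / q) ^ b) = trigMoment a b := by
  have h := trapezoidalExact_cos_pow_mul_sin_pow_mul_exp (q := q) (by omega) a b 0
    (by simpa using hab)
  simp only [TrapezoidalExact, Int.cast_zero, zero_mul, Complex.exp_zero, mul_one, ← Complex.ofReal_pow,
    ← Complex.ofReal_mul, intervalIntegral.integral_ofReal, ← Complex.ofReal_sum] at h
  exact Complex.ofReal_injective h

lemma trigMoment_derivative (a b : ℕ) :
    ((b : ℝ) + 1) * trigMoment (a + 2) b = (a + 1) * trigMoment a (b + 2) := by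
  have hint : ∀ c d : ℕ, IntervalIntegrable (fun θ => Real.cos θ ^ c * Real.sin θ ^ d)
      volume 0 (2 * π) := fun c d => Continuous.intervalIntegrable (by fun_prop) _ _
  have hderiv : ∀ θ ∈ Set.uIcc 0 (2 * π),
      HasDerivAt (fun θ => Real.cos θ ^ (a + 1) * Real.sin θ ^ (b + 1))
        (((b : ℝ) + 1) * (Real.cos θ ^ (a + 2) * Real.sin θ ^ b) -
          (a + 1) * (Real.cos θ ^ a * Real.sin θ ^ (b + 2))) θ := by
    intro θ _
    refine (((Real.hasDerivAt_cos θ).pow (a + 1)).mul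
      ((Real.hasDerivAt_sin θ).pow (b + 1))).congr_deriv ?_
    simp only [Pi.pow_apply, add_tsub_cancel_right]
    push_cast
    ring
  have h := intervalIntegral.integral_eq_sub_of_hasDerivAt hderiv
    (((hint _ _).const_mul _).sub ((hint _ _).const_mul _))
  rw [intervalIntegral.integral_sub ((hint _ _).const_mul _) ((hint _ _).const_mul _),
    intervalIntegral.integral_const_mul, intervalIntegral.integral_const_mul] at h
  simp at h
  simp only [trigMoment]
  linarith

lemma trigMoment_add (a b : ℕ) :
    trigMoment (a + 2) b + trigMoment a (b + 2) = trigMoment a b := by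
  simp only [trigMoment]
  rw [← intervalIntegral.integral_add (Continuous.intervalIntegrable (by fun_prop) _ _)
    (Continuous.intervalIntegrable (by fun_prop) _ _)]
  congr 1
  ext θ
  linear_combination Real.cos θ ^ a * Real.sin θ ^ b * Real.sin_sq_add_cos_sq θ

lemma trigMoment_add_two_left (a b : ℕ) :
    ((a : ℝ) + b + 2) * trigMoment (a + 2) b = (a + 1) * trigMoment a b := by
  linear_combination trigMoment_derivative a b + (a + 1) * trigMoment_add a b

lemma trigMoment_add_two_right (a b : ℕ) :
    ((a : ℝ) + b + 2) * trigMoment a (b + 2) = (b + 1) * trigMoment a b := by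
  linear_combination -trigMoment_derivative a b + (b + 1) * trigMoment_add a b

lemma trigMoment_one_left (b : ℕ) : trigMoment 1 b = 0 := by
  have hderiv : ∀ θ ∈ Set.uIcc 0 (2 * π),
      HasDerivAt (fun θ => Real.sin θ ^ (b + 1))
        (((b : ℝ) + 1) * (Real.cos θ ^ 1 * Real.sin θ ^ b)) θ := by
    intro θ _
    refine ((Real.hasDerivAt_sin θ).pow (b + 1)).congr_deriv ?_
    simp only [add_tsub_cancel_right]
    push_cast
    ring
  have h := intervalIntegral.integral_eq_sub_of_hasDerivAt hderiv
    (Continuous.intervalIntegrable (by fun_prop) _ _)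
  rw [intervalIntegral.integral_const_mul] at h
  have hb : (b : ℝ) + 1 ≠ 0 := by positivity
  simpa [hb, trigMoment] using h

lemma trigMoment_zero_one : trigMoment 0 1 = 0 := by
  simp [trigMoment]

lemma trigMoment_zero_zero : trigMoment 0 0 = 2 * π := by
  simp [trigMoment]

lemma trigMoment_eq_zero_of_odd_left {a : ℕ} (ha : Odd a) (b : ℕ) : trigMoment a b = 0 := by
  obtain ⟨k, rfl⟩ := ha
  induction k with
  | zero => exact trigMoment_one_left b
  | succ k ih =>
    have h := trigMoment_add_two_left (2 * k + 1) b
    rw [ih, mul_zero] at h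
    exact (mul_eq_zero.1 h).resolve_left (by positivity)

lemma trigMoment_eq_zero_of_odd_right (a : ℕ) {b : ℕ} (hb : Odd b) : trigMoment a b = 0 := by
  induction a using Nat.twoStepInduction with
  | zero =>
    obtain ⟨k, rfl⟩ := hb
    induction k with
    | zero => exact trigMoment_zero_one
    | succ k ih =>
      have h := trigMoment_add_two_right 0 (2 * k + 1)
      rw [ih, mul_zero] at h
      exact (mul_eq_zero.1 h).resolve_left (by positivity)
  | one => exact trigMoment_one_left b
  | more a ih _ =>
    have h := trigMoment_add_two_left a b
    rw [ih, mul_zero] at h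
    exact (mul_eq_zero.1 h).resolve_left (by positivity)

end TrigonometricQuadrature

section Moments

open Polynomial

/-- The Cartesian and the spherical evaluations of `∫_{B₃} x^a y^b z^c` agree. -/
lemma cartesian_moment_eq_spherical_moment (a b c : ℕ) :
    ((a : ℝ) + b + c + 3) * (weightedIntegral (b + c + 2) (X ^ a) *
        (weightedIntegral (c + 1) (X ^ b) * weightedIntegral 0 (X ^ c))) =
      trigMoment a b * weightedIntegral (a + b) (X ^ c) := by
  induction a using Nat.twoStepInduction with
  | one => simp [weightedIntegral_X, trigMoment_one_left]
  | more a ih _ =>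
    have h1 := weightedIntegral_X_pow_add_two (b + c + 2) a
    have h2 := trigMoment_add_two_left a b
    have h3 := weightedIntegral_add_two_X_pow (a + b) c
    rw [show a + b + 2 = a + 2 + b by ring] at h3
    push_cast at h1 h2 h3 ⊢
    have p1 : (a : ℝ) + b + 2 ≠ 0 := by positivity
    have p2 : (a : ℝ) + b + c + 3 ≠ 0 := by positivity
    refine mul_left_cancel₀ (mul_ne_zero p1 p2) ?_
    generalize weightedIntegral (c + 1) (X ^ b) * weightedIntegral 0 (X ^ c) = R at *
    linear_combination ((a : ℝ) + b + 2) * (a + b + c + 3) * R * h1 + ((a : ℝ) + b + 2) * (a + 1) * ih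
      - ((a : ℝ) + b + c + 3) * weightedIntegral (a + 2 + b) (X ^ c) * h2
      - (a + 1) * trigMoment a b * h3
  | zero =>
    induction b using Nat.twoStepInduction with
    | one => simp [weightedIntegral_X, trigMoment_zero_one]
    | more b ih _ =>
      have h1 := weightedIntegral_X_pow_add_two (c + 1) b
      have h2 := trigMoment_add_two_right 0 b
      have h3 := weightedIntegral_add_two_X_pow (0 + b) c
      have h4 := weightedIntegral_add_two_X_pow (b + c + 2) 0
      rw [show 0 + b + 2 = 0 + (b + 2) by ring] at h3
      rw [show b + c + 2 + 2 = b + 2 + c + 2 by ring] at h4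
      push_cast at ih h1 h2 h3 h4 ⊢
      simp only [zero_add, add_zero] at ih h1 h2 h3 h4 ⊢
      have p1 : (b : ℝ) + 2 ≠ 0 := by positivity
      have p2 : (b : ℝ) + c + 4 ≠ 0 := by positivity
      have p3 : (b : ℝ) + c + 3 ≠ 0 := by positivity
      refine mul_left_cancel₀ (mul_ne_zero (mul_ne_zero p1 p2) p3) ?_
      linear_combination ((b : ℝ) + 2) * (b + c + 3) * weightedIntegral 0 (X ^ c) * (b + c + 4) *
          (weightedIntegral (c + 1) (X ^ (b + 2)) * h4 +
            weightedIntegral (b + c + 2) (X ^ 0) * h1)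
        + ((b : ℝ) + 2) * (b + 1) * (b + c + 4) * ih
        - ((b : ℝ) + c + 4) * ((b + c + 3) * weightedIntegral (b + 2) (X ^ c) * h2 +
            (b + 1) * trigMoment 0 b * h3)
    | zero =>
      induction c using Nat.twoStepInduction with
      | one => simp [weightedIntegral_X]
      | more c ih _ =>
        have h1 := weightedIntegral_X_pow_add_two 0 c
        have h2 := weightedIntegral_add_two_X_pow (c + 1) 0
        have h3 := weightedIntegral_add_two_X_pow (c + 2) 0
        push_cast at ih h1 h2 h3 ⊢
        simp only [zero_add, add_zero] at ih h1 h2 h3 ⊢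
        have p1 : (c : ℝ) + 3 ≠ 0 := by positivity
        have p2 : (c : ℝ) + 4 ≠ 0 := by positivity
        refine mul_left_cancel₀ (mul_ne_zero p1 p2) ?_
        linear_combination ((c : ℝ) + 4) * (c + 3) *
            (weightedIntegral (c + 2 + 1) (X ^ 0) * weightedIntegral 0 (X ^ (c + 2)) * h3 +
              weightedIntegral (c + 2) (X ^ 0) * weightedIntegral 0 (X ^ (c + 2)) * h2 +
              weightedIntegral (c + 2) (X ^ 0) * weightedIntegral (c + 1) (X ^ 0) * h1)
          + ((c : ℝ) + 4) * (c + 1) * ih - ((c : ℝ) + 4) * trigMoment 0 0 * h1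
      | zero =>
        have h := weightedIntegral_add_two_X_pow 0 0
        simp [weightedIntegral_zero_one, weightedIntegral_one_one, trigMoment_zero_zero] at h ⊢
        linear_combination π * h

end Moments

section CubeIntegral

open Polynomial

/-- The parametrization of the unit ball by the cube `[-1, 1]³`. -/
noncomputable def ballPoint (x u v : ℝ) : Fin 3 → ℝ :=
  ![x, √(1 - x ^ 2) * u, √(1 - x ^ 2) * √(1 - u ^ 2) * v]

/-- The cube, written with half-open sides. -/
def cube : Set (ℝ × ℝ × ℝ) := Set.Ioc (-1) 1 ×ˢ (Set.Ioc (-1) 1 ×ˢ Set.Ioc (-1) 1)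

/-- The integrand of `∫_{B₃} p`, transported to the cube. -/
noncomputable def cubeIntegrand (p : MvPolynomial (Fin 3) ℝ) (w : ℝ × ℝ × ℝ) : ℝ :=
  √(1 - w.1 ^ 2) ^ 2 * √(1 - w.2.1 ^ 2) * MvPolynomial.eval (ballPoint w.1 w.2.1 w.2.2) p

lemma integrableOn_cubeIntegrand (p : MvPolynomial (Fin 3) ℝ) :
    IntegrableOn (cubeIntegrand p) cube := by
  have hK : IsCompact (Set.Icc (-1 : ℝ) 1 ×ˢ (Set.Icc (-1 : ℝ) 1 ×ˢ Set.Icc (-1 : ℝ) 1)) :=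
    isCompact_Icc.prod (isCompact_Icc.prod isCompact_Icc)
  have hpt : Continuous fun w : ℝ × ℝ × ℝ => ballPoint w.1 w.2.1 w.2.2 := by
    refine continuous_pi fun i => ?_
    fin_cases i <;> simp [ballPoint] <;> fun_prop
  have hcont : Continuous (cubeIntegrand p) := by
    have := (MvPolynomial.continuous_eval p).comp hpt
    unfold cubeIntegrand
    simp only [Function.comp_def] at this
    fun_prop
  refine (hcont.continuousOn.integrableOn_compact hK).mono_set ?_
  exact Set.prod_mono Set.Ioc_subset_Icc_self
    (Set.prod_mono Set.Ioc_subset_Icc_self Set.Ioc_subset_Icc_self)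

/-- The functional `p ↦ ∫_{B₃} p`, computed on the cube. -/
noncomputable def cubeIntegral : MvPolynomial (Fin 3) ℝ →ₗ[ℝ] ℝ where
  toFun p := ∫ w in cube, cubeIntegrand p w
  map_add' p p' := by
    rw [← integral_add (integrableOn_cubeIntegrand p) (integrableOn_cubeIntegrand p')]
    simp only [cubeIntegrand, map_add, mul_add]
  map_smul' c p := by
    rw [RingHom.id_apply, smul_eq_mul, ← integral_const_mul]
    simp only [cubeIntegrand, MvPolynomial.smul_eval]
    congr 1
    ext w
    ring

lemma cubeIntegral_of_factor {p : MvPolynomial (Fin 3) ℝ} {f g h : ℝ[X]} {L M N : ℕ}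
    (hp : ∀ w ∈ cube, cubeIntegrand p w = (f.eval w.1 * √(1 - w.1 ^ 2) ^ L) *
      ((g.eval w.2.1 * √(1 - w.2.1 ^ 2) ^ M) * (h.eval w.2.2 * √(1 - w.2.2 ^ 2) ^ N))) :
    cubeIntegral p =
      weightedIntegral L f * (weightedIntegral M g * weightedIntegral N h) := by
  have hm : MeasurableSet cube := measurableSet_Ioc.prod (measurableSet_Ioc.prod measurableSet_Ioc)
  have h1 : cubeIntegral p = ∫ w in cube, cubeIntegrand p w := rfl
  rw [h1, setIntegral_congr_fun hm hp, cube]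
  simp only [weightedIntegral_apply, intervalIntegral.integral_of_le (show (-1 : ℝ) ≤ 1 by norm_num)]
  rw [← setIntegral_prod_mul, ← setIntegral_prod_mul]
  rfl

lemma cubeIntegral_monomial (s : Fin 3 →₀ ℕ) :
    cubeIntegral (MvPolynomial.monomial s 1) =
      weightedIntegral (s 1 + s 2 + 2) (X ^ s 0) *
        (weightedIntegral (s 2 + 1) (X ^ s 1) * weightedIntegral 0 (X ^ s 2)) := by
  refine cubeIntegral_of_factor fun w _ => ?_
  rw [cubeIntegrand, MvPolynomial.eval_monomial, Finsupp.prod_fintype _ _ (by simp),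
    Fin.prod_univ_three]
  simp [ballPoint]
  ring

/-- The unnormalized polynomial basis of the ball, homogenized so as to be a polynomial. -/
noncomputable def ballBasis (a j k : ℕ) : MvPolynomial (Fin 3) ℝ :=
  homGegenbauer ((j : ℝ) + k + 3 / 2) (MvPolynomial.X 0) 1 a *
    homGegenbauer ((k : ℝ) + 1) (MvPolynomial.X 1) (1 - MvPolynomial.X 0 ^ 2) j *
    homGegenbauer (1 / 2) (MvPolynomial.X 2)
      (1 - MvPolynomial.X 0 ^ 2 - MvPolynomial.X 1 ^ 2) k

lemma eval_ballBasis (a j k : ℕ) (v : Fin 3 → ℝ) :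
    MvPolynomial.eval v (ballBasis a j k) =
      gegenbauer ((j : ℝ) + k + 3 / 2) a (v 0) *
        homGegenbauer ((k : ℝ) + 1) (v 1) (1 - v 0 ^ 2) j *
        homGegenbauer (1 / 2 : ℝ) (v 2) (1 - v 0 ^ 2 - v 1 ^ 2) k := by
  have h (p : MvPolynomial (Fin 3) ℝ) : MvPolynomial.eval v p = MvPolynomial.aeval v p := by
    rw [← MvPolynomial.coe_aeval_eq_eval]
    rfl
  simp only [h, ballBasis, map_mul, map_homGegenbauer, map_sub, map_pow, map_one,
    MvPolynomial.aeval_X, homGegenbauer_one_eq]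

lemma totalDegree_ballBasis_le (a j k : ℕ) : (ballBasis a j k).totalDegree ≤ a + j + k := by
  have hX (i : Fin 3) : (MvPolynomial.X i : MvPolynomial (Fin 3) ℝ).totalDegree ≤ 1 :=
    (MvPolynomial.totalDegree_X i).le
  have hX2 (i : Fin 3) : (MvPolynomial.X i ^ 2 : MvPolynomial (Fin 3) ℝ).totalDegree ≤ 2 :=
    (MvPolynomial.totalDegree_X_pow i 2).le
  have h1 : (1 : MvPolynomial (Fin 3) ℝ).totalDegree ≤ 2 := by simp
  have hs : (1 - MvPolynomial.X 0 ^ 2 : MvPolynomial (Fin 3) ℝ).totalDegree ≤ 2 :=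
    (MvPolynomial.totalDegree_sub _ _).trans (max_le h1 (hX2 0))
  have ht : (1 - MvPolynomial.X 0 ^ 2 - MvPolynomial.X 1 ^ 2 :
      MvPolynomial (Fin 3) ℝ).totalDegree ≤ 2 :=
    (MvPolynomial.totalDegree_sub _ _).trans (max_le hs (hX2 1))
  refine (MvPolynomial.totalDegree_mul _ _).trans (add_le_add
    ((MvPolynomial.totalDegree_mul _ _).trans (add_le_add ?_ ?_)) ?_)
  · exact totalDegree_homGegenbauer_le _ (hX 0) h1 a
  · exact totalDegree_homGegenbauer_le _ (hX 1) hs j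
  · exact totalDegree_homGegenbauer_le _ (hX 2) ht k

lemma eval_ballPoint_ballBasis (a j k : ℕ) {x u : ℝ} (v : ℝ) (hx : x ^ 2 ≤ 1) (hu : u ^ 2 ≤ 1) :
    MvPolynomial.eval (ballPoint x u v) (ballBasis a j k) =
      gegenbauer ((j : ℝ) + k + 3 / 2) a x * (√(1 - x ^ 2) ^ j * gegenbauer ((k : ℝ) + 1) j u) *
        ((√(1 - x ^ 2) * √(1 - u ^ 2)) ^ k * gegenbauer (1 / 2) k v) := by
  have h1 : 1 - x ^ 2 = √(1 - x ^ 2) ^ 2 := (Real.sq_sqrt (by linarith)).symm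
  have h2 : 1 - x ^ 2 - (√(1 - x ^ 2) * u) ^ 2 = (√(1 - x ^ 2) * √(1 - u ^ 2)) ^ 2 := by
    rw [mul_pow, mul_pow, ← h1, Real.sq_sqrt (by linarith)]
    ring
  rw [← homGegenbauer_mul_sq, ← homGegenbauer_mul_sq, ← h2, ← h1, eval_ballBasis]
  rfl

/-- The squared norm of `ballBasis a j k` in `L²(B₃)`. -/
noncomputable def ballNormSq (a j k : ℕ) : ℝ :=
  Nsq (1 / 2) k * Nsq ((k : ℝ) + 1) j * Nsq ((j : ℝ) + (k : ℝ) + 3 / 2) a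

lemma ballNormSq_pos (a j k : ℕ) : 0 < ballNormSq a j k :=
  mul_pos (mul_pos (Nsq_pos (by norm_num) k) (Nsq_pos (by positivity) j))
    (Nsq_pos (by positivity) a)

lemma cubeIntegral_ballBasis_mul (a j k a' j' k' : ℕ) :
    cubeIntegral (ballBasis a j k * ballBasis a' j' k') =
      if a = a' ∧ j = j' ∧ k = k' then ballNormSq a j k else 0 := by
  have h : cubeIntegral (ballBasis a j k * ballBasis a' j' k') =
      weightedIntegral (j + k + j' + k' + 2) (gegenbauerPoly ((j : ℝ) + k + 3 / 2) a *
          gegenbauerPoly ((j' : ℝ) + k' + 3 / 2) a') *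
        (weightedIntegral (k + k' + 1)
            (gegenbauerPoly ((k : ℝ) + 1) j * gegenbauerPoly ((k' : ℝ) + 1) j') *
          weightedIntegral 0 (gegenbauerPoly (1 / 2) k * gegenbauerPoly (1 / 2) k')) := by
    refine cubeIntegral_of_factor fun w hw => ?_
    obtain ⟨hx, hu, -⟩ := hw
    have hx' : w.1 ^ 2 ≤ 1 := by nlinarith [hx.1, hx.2]
    have hu' : w.2.1 ^ 2 ≤ 1 := by nlinarith [hu.1, hu.2]
    rw [cubeIntegrand, map_mul, eval_ballPoint_ballBasis _ _ _ _ hx' hu',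
      eval_ballPoint_ballBasis _ _ _ _ hx' hu']
    simp only [eval_mul, eval_gegenbauerPoly]
    ring
  rw [h]
  by_cases hk : k = k'
  · subst hk
    by_cases hj : j = j'
    · subst hj
      rw [weightedIntegral_gegenbauer (by push_cast; ring),
        weightedIntegral_gegenbauer (by push_cast; ring),
        weightedIntegral_gegenbauer (by push_cast; ring), ballNormSq]
      by_cases ha : a = a'
      · simp [ha]
        ring
      · simp [ha]
    · rw [weightedIntegral_gegenbauer (M := k + k + 1) (by push_cast; ring)]
      simp [hj]
  · rw [weightedIntegral_gegenbauer (M := 0) (by norm_num)]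
    simp [hk]

end CubeIntegral

section Expansion

lemma linearIndependent_ballBasis (ι : Type*) (e : ι → Fin 3 →₀ ℕ) (he : Function.Injective e) :
    LinearIndependent ℝ fun i => ballBasis (e i 0) (e i 1) (e i 2) := by
  classical
  rw [linearIndependent_iff']
  intro t g hg i hi
  have h := congrArg (fun p => cubeIntegral (p * ballBasis (e i 0) (e i 1) (e i 2))) hg
  simp only [Finset.sum_mul, smul_mul_assoc, map_sum, map_smul, cubeIntegral_ballBasis_mul,
    zero_mul, map_zero] at h
  rw [Finset.sum_eq_single_of_mem i hi] at h
  · simpa [(ballNormSq_pos _ _ _).ne'] using h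
  · intro i' _ hne
    rw [if_neg, smul_zero]
    rintro ⟨h0, h1, h2⟩
    refine hne (he (Finsupp.ext fun l => ?_))
    fin_cases l
    · exact h0
    · exact h1
    · exact h2

lemma sum_fin_three (s : Fin 3 →₀ ℕ) : (s.sum fun _ e => e) = s 0 + s 1 + s 2 := by
  rw [Finsupp.sum_fintype _ _ (by simp), Fin.sum_univ_three]

lemma mem_span_ballBasis {n : ℕ} {p : MvPolynomial (Fin 3) ℝ} (hp : p.totalDegree ≤ n) :
    p ∈ Submodule.span ℝ {b | ∃ a j k, a + j + k ≤ n ∧ b = ballBasis a j k} := by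
  set S : Set (Fin 3 →₀ ℕ) := {s | (s.sum fun _ e => e) ≤ n} with hS
  set V := MvPolynomial.restrictTotalDegree (Fin 3) ℝ n with hV
  have hfin : S.Finite := Finsupp.finite_of_degree_le n
  have : Fintype S := hfin.fintype
  let basis : Module.Basis S ℝ V := MvPolynomial.basisRestrictSupport ℝ S
  have : FiniteDimensional ℝ V := Module.Finite.of_basis basis
  let b : S → V := fun s => ⟨ballBasis (s.1 0) (s.1 1) (s.1 2), by
    rw [hV, MvPolynomial.mem_restrictTotalDegree]
    exact (totalDegree_ballBasis_le _ _ _).trans (sum_fin_three s.1 ▸ s.2)⟩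
  have hb : LinearIndependent ℝ b :=
    LinearIndependent.of_comp V.subtype
      (linearIndependent_ballBasis S Subtype.val Subtype.val_injective)
  have htop := hb.span_eq_top_of_card_eq_finrank' (Module.finrank_eq_card_basis basis).symm
  have hpV : p ∈ V := by rwa [hV, MvPolynomial.mem_restrictTotalDegree]
  have hmem : (⟨p, hpV⟩ : V) ∈ Submodule.span ℝ (Set.range b) := htop ▸ Submodule.mem_top
  have hmap := Submodule.mem_map_of_mem (f := V.subtype) hmem
  rw [Submodule.map_span] at hmap
  refine Submodule.span_mono ?_ hmap
  rintro _ ⟨_, ⟨s, rfl⟩, rfl⟩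
  exact ⟨s.1 0, s.1 1, s.1 2, sum_fin_three s.1 ▸ s.2, rfl⟩

lemma ballBasis_expansion {n : ℕ} {p : MvPolynomial (Fin 3) ℝ} (hp : p.totalDegree ≤ n) :
    p = ∑ m ∈ Finset.range (n + 1), ∑ j ∈ Finset.range (m + 1), ∑ k ∈ Finset.range (m + 1 - j),
      (cubeIntegral (p * ballBasis (m - j - k) j k) / ballNormSq (m - j - k) j k) •
        ballBasis (m - j - k) j k := by
  have hspan := mem_span_ballBasis hp
  clear hp
  induction hspan using Submodule.span_induction with
  | zero => simp
  | add p p' _ _ ih ih' =>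
    simp only [add_mul, map_add, add_div, add_smul, Finset.sum_add_distrib]
    rw [← ih, ← ih']
  | smul c p _ ih =>
    simp only [smul_mul_assoc, map_smul, smul_eq_mul, mul_div_assoc, mul_smul, ← Finset.smul_sum]
    rw [← ih]
  | mem p hp =>
    obtain ⟨a, j, k, hn, rfl⟩ := hp
    have hzero {m j' k' : ℕ} (hk' : k' ∈ Finset.range (m + 1 - j'))
        (hne : ¬(a + j + k = m ∧ j = j' ∧ k = k')) :
        (cubeIntegral (ballBasis a j k * ballBasis (m - j' - k') j' k') /
          ballNormSq (m - j' - k') j' k') • ballBasis (m - j' - k') j' k' = 0 := by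
      rw [cubeIntegral_ballBasis_mul, if_neg, zero_div, zero_smul]
      rw [Finset.mem_range] at hk'
      omega
    rw [Finset.sum_eq_single_of_mem (a + j + k) (by simp; omega),
      Finset.sum_eq_single_of_mem j (by simp; omega),
      Finset.sum_eq_single_of_mem k (by simp; omega)]
    · have ha : a + j + k - j - k = a := by omega
      rw [ha, cubeIntegral_ballBasis_mul, if_pos ⟨rfl, rfl, rfl⟩,
        div_self (ballNormSq_pos _ _ _).ne', one_smul]
    · exact fun k' hk' hne => hzero hk' (by omega)
    · exact fun j' _ hne => Finset.sum_eq_zero fun k' hk' => hzero hk' (by omega)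
    · exact fun m _ hne => Finset.sum_eq_zero fun j' _ => Finset.sum_eq_zero fun k' hk' =>
        hzero hk' (by omega)

end Expansion

section Quadrature

/-- The point of the ball with spherical coordinates `(r, θ, arccos t)`. -/
noncomputable def sphericalPoint (r t θ : ℝ) : Fin 3 → ℝ :=
  ![r * Real.sin (Real.arccos t) * Real.cos θ, r * Real.sin (Real.arccos t) * Real.sin θ,
    r * Real.cos (Real.arccos t)]

/-- The quadrature rule on the ball, applied to polynomials. -/
noncomputable def ballQuadrature (q : ℕ) (ζ ν ξ ω : ℕ → ℝ) : MvPolynomial (Fin 3) ℝ →ₗ[ℝ] ℝ where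
  toFun p := ∑ i ∈ Finset.Icc 1 (2 * q), ∑ j ∈ Finset.Icc 1 q, ∑ k ∈ Finset.Icc 1 q,
    (π / q) * ω j * ν k * MvPolynomial.eval (sphericalPoint ((ζ k + 1) / 2) (ξ j) (π * i / q)) p
  map_add' p p' := by
    simp only [map_add, mul_add, Finset.sum_add_distrib]
  map_smul' c p := by
    simp only [MvPolynomial.smul_eval, RingHom.id_apply, smul_eq_mul, Finset.mul_sum,
      mul_left_comm c]

lemma ballQuadrature_apply (q : ℕ) (ζ ν ξ ω : ℕ → ℝ) (p : MvPolynomial (Fin 3) ℝ) :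
    ballQuadrature q ζ ν ξ ω p =
      ∑ i ∈ Finset.Icc 1 (2 * q), ∑ j ∈ Finset.Icc 1 q, ∑ k ∈ Finset.Icc 1 q,
        (π / q) * ω j * ν k *
          MvPolynomial.eval (sphericalPoint ((ζ k + 1) / 2) (ξ j) (π * i / q)) p := rfl

lemma one_sub_sq_nonneg {t : ℝ} (ht : t ∈ Set.Icc (-1 : ℝ) 1) : 0 ≤ 1 - t ^ 2 := by
  nlinarith [ht.1, ht.2]

open Polynomial in
lemma ballQuadrature_monomial {q : ℕ} {ζ ν ξ ω : ℕ → ℝ}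
    (hξ : ∀ j ∈ Finset.Icc 1 q, ξ j ∈ Set.Icc (-1 : ℝ) 1)
    (hrad : ∀ v : Polynomial ℝ, v.natDegree ≤ 2 * q - 1 →
      (∫ r in (0 : ℝ)..1, r ^ 2 * v.eval r) =
        ∑ k ∈ Finset.Icc 1 q, ν k * v.eval ((ζ k + 1) / 2))
    (hleg : ∀ w : Polynomial ℝ, w.natDegree ≤ 2 * q - 1 →
      (∫ t in (-1 : ℝ)..1, w.eval t) =
        ∑ j ∈ Finset.Icc 1 q, ω j * w.eval (ξ j))
    {s : Fin 3 →₀ ℕ} (hs : s 0 + s 1 + s 2 < 2 * q) :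
    ballQuadrature q ζ ν ξ ω (MvPolynomial.monomial s 1) =
      cubeIntegral (MvPolynomial.monomial s 1) := by
  have hfac : ballQuadrature q ζ ν ξ ω (MvPolynomial.monomial s 1) =
      (∑ i ∈ Finset.Icc 1 (2 * q),
        π / q * (Real.cos (π * i / q) ^ s 0 * Real.sin (π * i / q) ^ s 1)) *
      ((∑ j ∈ Finset.Icc 1 q, ω j * (√(1 - ξ j ^ 2) ^ (s 0 + s 1) * ξ j ^ s 2)) *
        ∑ k ∈ Finset.Icc 1 q, ν k * ((ζ k + 1) / 2) ^ (s 0 + s 1 + s 2)) := by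
    rw [ballQuadrature_apply, Finset.sum_mul]
    refine Finset.sum_congr rfl fun i _ => ?_
    rw [Finset.sum_mul_sum, Finset.mul_sum]
    refine Finset.sum_congr rfl fun j hj => ?_
    rw [Finset.mul_sum]
    refine Finset.sum_congr rfl fun k _ => ?_
    rw [MvPolynomial.eval_monomial, Finsupp.prod_fintype _ _ (by simp), Fin.prod_univ_three]
    simp only [sphericalPoint, Real.sin_arccos, Real.cos_arccos (hξ j hj).1 (hξ j hj).2,
      Matrix.cons_val]
    generalize (ζ k + 1) / 2 = r
    ring
  have hrad' : ((s 0 : ℝ) + s 1 + s 2 + 3) *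
      ∑ k ∈ Finset.Icc 1 q, ν k * ((ζ k + 1) / 2) ^ (s 0 + s 1 + s 2) = 1 := by
    have h := hrad (X ^ (s 0 + s 1 + s 2)) (by rw [natDegree_X_pow]; omega)
    simp only [eval_pow, eval_X, ← pow_add] at h
    rw [← h, integral_pow]
    have : (s 0 : ℝ) + s 1 + s 2 + 3 ≠ 0 := by positivity
    push_cast
    rw [show 2 + ((s 0 : ℝ) + s 1 + s 2) + 1 = s 0 + s 1 + s 2 + 3 by ring]
    simp [this]
  have hmain := cartesian_moment_eq_spherical_moment (s 0) (s 1) (s 2)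
  rw [← cubeIntegral_monomial] at hmain
  have hleg' : trigMoment (s 0) (s 1) * (∑ j ∈ Finset.Icc 1 q,
      ω j * (√(1 - ξ j ^ 2) ^ (s 0 + s 1) * ξ j ^ s 2)) =
      trigMoment (s 0) (s 1) * weightedIntegral (s 0 + s 1) (X ^ s 2) := by
    rcases Nat.even_or_odd (s 0 + s 1) with ⟨d, hd⟩ | hodd
    · have hpow {t : ℝ} (ht : t ∈ Set.Icc (-1 : ℝ) 1) :
          √(1 - t ^ 2) ^ (d + d) = (1 - t ^ 2) ^ d := by
        rw [← two_mul, pow_mul, Real.sq_sqrt (one_sub_sq_nonneg ht)]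
      have hdeg : ((1 - X ^ 2) ^ d * X ^ s 2 : ℝ[X]).natDegree ≤ 2 * q - 1 := by
        have : ((1 - X ^ 2) ^ d * X ^ s 2 : ℝ[X]).natDegree ≤ d * 2 + s 2 := by compute_degree
        omega
      have h := hleg _ hdeg
      simp only [eval_mul, eval_pow, eval_sub, eval_one, eval_X] at h
      rw [hd]
      congr 1
      rw [weightedIntegral_apply]
      calc _ = ∑ j ∈ Finset.Icc 1 q, ω j * ((1 - ξ j ^ 2) ^ d * ξ j ^ s 2) :=
            Finset.sum_congr rfl fun j hj => by rw [hpow (hξ j hj)]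
        _ = _ := h.symm
        _ = _ := by
            refine intervalIntegral.integral_congr fun t ht => ?_
            rw [Set.uIcc_of_le (by norm_num)] at ht
            simp only [hpow ht, eval_pow, eval_X]
            ring
    · have h0 : trigMoment (s 0) (s 1) = 0 := by
        rcases Nat.even_or_odd (s 0) with h0 | h0
        · rcases Nat.even_or_odd (s 1) with h1 | h1
          · exact absurd (h0.add h1) (Nat.not_even_iff_odd.2 hodd)
          · exact trigMoment_eq_zero_of_odd_right _ h1
        · exact trigMoment_eq_zero_of_odd_left h0 _
      simp [h0]
  rw [hfac, trapezoidal_cos_pow_mul_sin_pow (by omega), ← mul_assoc, hleg', ← hmain]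
  linear_combination cubeIntegral (MvPolynomial.monomial s 1) * hrad'

lemma ballQuadrature_eq_cubeIntegral {q : ℕ} {ζ ν ξ ω : ℕ → ℝ}
    (hξ : ∀ j ∈ Finset.Icc 1 q, ξ j ∈ Set.Icc (-1 : ℝ) 1)
    (hrad : ∀ v : Polynomial ℝ, v.natDegree ≤ 2 * q - 1 →
      (∫ r in (0 : ℝ)..1, r ^ 2 * v.eval r) =
        ∑ k ∈ Finset.Icc 1 q, ν k * v.eval ((ζ k + 1) / 2))
    (hleg : ∀ w : Polynomial ℝ, w.natDegree ≤ 2 * q - 1 →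
      (∫ t in (-1 : ℝ)..1, w.eval t) =
        ∑ j ∈ Finset.Icc 1 q, ω j * w.eval (ξ j))
    {p : MvPolynomial (Fin 3) ℝ} (hp : p.totalDegree < 2 * q) :
    ballQuadrature q ζ ν ξ ω p = cubeIntegral p := by
  rw [p.as_sum, map_sum, map_sum]
  refine Finset.sum_congr rfl fun s hs => ?_
  have h : MvPolynomial.monomial s (p.coeff s) = p.coeff s • MvPolynomial.monomial s (1 : ℝ) := by
    rw [MvPolynomial.smul_monomial, smul_eq_mul, mul_one]
  rw [h, map_smul, map_smul, ballQuadrature_monomial hξ hrad hleg]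
  rw [← sum_fin_three]
  exact (MvPolynomial.le_totalDegree hs).trans_lt hp

end Quadrature

lemma homGegenbauer_sq_eq {lam y r : ℝ} (n : ℕ) (hr : r = 0 → y = 0) :
    homGegenbauer lam y (r ^ 2) n = r ^ n * gegenbauer lam n (y / r) := by
  rw [← homGegenbauer_mul_sq]
  congr 1
  by_cases h : r = 0
  · simp [h, hr h]
  · field_simp

lemma Q3_eq_eval_ballBasis (m j k : ℕ) {v : Fin 3 → ℝ} (hv : v 0 ^ 2 + v 1 ^ 2 + v 2 ^ 2 ≤ 1) :
    Q3 m j k (v 0) (v 1) (v 2) =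
      (1 / √(ballNormSq (m - j - k) j k)) * MvPolynomial.eval v (ballBasis (m - j - k) j k) := by
  have hx : 0 ≤ 1 - v 0 ^ 2 := by nlinarith [sq_nonneg (v 1), sq_nonneg (v 2)]
  have hy : 0 ≤ 1 - v 0 ^ 2 - v 1 ^ 2 := by nlinarith [sq_nonneg (v 2)]
  have hrpow {t : ℝ} (ht : 0 ≤ t) (d : ℕ) : t ^ ((d : ℝ) / 2) = √t ^ d := by
    rw [Real.sqrt_eq_rpow, ← Real.rpow_natCast, ← Real.rpow_mul ht]
    congr 1
    ring
  have h1 := homGegenbauer_sq_eq (lam := (k : ℝ) + 1) (y := v 1) (r := √(1 - v 0 ^ 2)) j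
    fun h => by
      rw [Real.sqrt_eq_zero hx] at h
      nlinarith [sq_nonneg (v 1), sq_nonneg (v 2)]
  have h2 := homGegenbauer_sq_eq (lam := 1 / 2) (y := v 2) (r := √(1 - v 0 ^ 2 - v 1 ^ 2)) k
    fun h => by
      rw [Real.sqrt_eq_zero hy] at h
      nlinarith [sq_nonneg (v 2)]
  rw [Real.sq_sqrt hx] at h1
  rw [Real.sq_sqrt hy] at h2
  rw [eval_ballBasis, h1, h2, Q3, hrpow hx, hrpow hy]
  simp only [h3, ballNormSq]
  ring

lemma sphericalPoint_mem {r t : ℝ} (hr : r ∈ Set.Icc (0 : ℝ) 1) (θ : ℝ) :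
    sphericalPoint r t θ 0 ^ 2 + sphericalPoint r t θ 1 ^ 2 + sphericalPoint r t θ 2 ^ 2 ≤ 1 := by
  have h : sphericalPoint r t θ 0 ^ 2 + sphericalPoint r t θ 1 ^ 2 + sphericalPoint r t θ 2 ^ 2 =
      r ^ 2 := by
    simp only [sphericalPoint, Matrix.cons_val]
    linear_combination r ^ 2 * Real.sin (Real.arccos t) ^ 2 * Real.sin_sq_add_cos_sq θ +
      r ^ 2 * Real.sin_sq_add_cos_sq (Real.arccos t)
  rw [h]
  exact pow_le_one₀ hr.1 hr.2

/-- the discrete `L²` projection on the unit ball, using the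
quadrature rule `Q_q` with `q ≥ n + 1`, reproduces all polynomials of total
degree at most `n`. -/
theorem ball_hyperinterpolation_reproduces (q n : ℕ) (hq : n + 1 ≤ q)
    (ζ ν ξ ω : ℕ → ℝ)
    (hζ : ∀ k ∈ Finset.Icc 1 q, ζ k ∈ Set.Icc (-1 : ℝ) 1)
    (hξ : ∀ j ∈ Finset.Icc 1 q, ξ j ∈ Set.Icc (-1 : ℝ) 1)
    (hrad : ∀ v : Polynomial ℝ, v.natDegree ≤ 2 * q - 1 →
      (∫ r in (0 : ℝ)..1, r ^ 2 * v.eval r) =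
        ∑ k ∈ Finset.Icc 1 q, ν k * v.eval ((ζ k + 1) / 2))
    (hleg : ∀ w : Polynomial ℝ, w.natDegree ≤ 2 * q - 1 →
      (∫ t in (-1 : ℝ)..1, w.eval t) =
        ∑ j ∈ Finset.Icc 1 q, ω j * w.eval (ξ j))
    (p : MvPolynomial (Fin 3) ℝ) (hp : p.totalDegree ≤ n)
    (x y z : ℝ) (hxyz : (x, y, z) ∈ unitBall3) :
    MvPolynomial.eval ![x, y, z] p =
      ∑ m ∈ Finset.range (n + 1), ∑ j ∈ Finset.range (m + 1),
        ∑ k ∈ Finset.range (m + 1 - j),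
        (∑ i ∈ Finset.Icc 1 (2 * q), ∑ j' ∈ Finset.Icc 1 q, ∑ k' ∈ Finset.Icc 1 q,
          (π / q) * ω j' * ν k' *
            (MvPolynomial.eval
                ![((ζ k' + 1) / 2) * Real.sin (Real.arccos (ξ j')) * Real.cos (π * i / q),
                  ((ζ k' + 1) / 2) * Real.sin (Real.arccos (ξ j')) * Real.sin (π * i / q),
                  ((ζ k' + 1) / 2) * Real.cos (Real.arccos (ξ j'))] p *
              Q3 m j k
                (((ζ k' + 1) / 2) * Real.sin (Real.arccos (ξ j')) * Real.cos (π * i / q))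
                (((ζ k' + 1) / 2) * Real.sin (Real.arccos (ξ j')) * Real.sin (π * i / q))
                (((ζ k' + 1) / 2) * Real.cos (Real.arccos (ξ j'))))) *
          Q3 m j k x y z := by
  have hball : (![x, y, z] : Fin 3 → ℝ) 0 ^ 2 + ![x, y, z] 1 ^ 2 + ![x, y, z] 2 ^ 2 ≤ 1 :=
    le_of_lt hxyz
  conv_lhs => rw [ballBasis_expansion hp]
  simp only [map_sum, MvPolynomial.smul_eval]
  refine Finset.sum_congr rfl fun m hm => Finset.sum_congr rfl fun j hj =>
    Finset.sum_congr rfl fun k hk => ?_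
  rw [Finset.mem_range] at hm hj hk
  have hdeg : (p * ballBasis (m - j - k) j k).totalDegree < 2 * q := by
    have h1 := MvPolynomial.totalDegree_mul p (ballBasis (m - j - k) j k)
    have h2 := totalDegree_ballBasis_le (m - j - k) j k
    omega
  rw [← ballQuadrature_eq_cubeIntegral hξ hrad hleg hdeg, ballQuadrature_apply]
  have hQ := Q3_eq_eval_ballBasis m j k hball
  simp only [Matrix.cons_val] at hQ
  have hsum : (∑ i ∈ Finset.Icc 1 (2 * q), ∑ j' ∈ Finset.Icc 1 q, ∑ k' ∈ Finset.Icc 1 q,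
          (π / q) * ω j' * ν k' *
            (MvPolynomial.eval (sphericalPoint ((ζ k' + 1) / 2) (ξ j') (π * i / q)) p *
              Q3 m j k (sphericalPoint ((ζ k' + 1) / 2) (ξ j') (π * i / q) 0)
                (sphericalPoint ((ζ k' + 1) / 2) (ξ j') (π * i / q) 1)
                (sphericalPoint ((ζ k' + 1) / 2) (ξ j') (π * i / q) 2))) =
      1 / √(ballNormSq (m - j - k) j k) *
        ballQuadrature q ζ ν ξ ω (p * ballBasis (m - j - k) j k) := by
    simp only [ballQuadrature_apply, Finset.mul_sum]
    refine Finset.sum_congr rfl fun i _ => Finset.sum_congr rfl fun j' _ =>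
      Finset.sum_congr rfl fun k' hk' => ?_
    have hr : (ζ k' + 1) / 2 ∈ Set.Icc (0 : ℝ) 1 := by
      have := hζ k' hk'
      constructor <;> linarith [this.1, this.2]
    rw [Q3_eq_eval_ballBasis m j k (sphericalPoint_mem hr _), map_mul]
    ring
  simp only [sphericalPoint, Matrix.cons_val] at hsum
  rw [hsum, hQ, ballQuadrature_apply]
  have hpos := ballNormSq_pos (m - j - k) j k
  have hne := (Real.sqrt_pos.2 hpos).ne'
  nth_rewrite 1 [← Real.sq_sqrt hpos.le]
  simp only [sphericalPoint]
  field_simp
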